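/- arXiv:1905.00041 — 11 statements merged into one kernel-verified Lean document; each statement's English description precedes it below -/
import Mathlib

section
/- Graphical addition of binary matrices (Lemma 4.6, addition part): for all natural numbers n, m and all matrices A, B over ZMod 2 of size m×n, M m * (P A ⊗ₖ P B) * Δ n = P (A + B), i.e. copying the input register, applying the maps |x⟩ ↦ |Ax⟩ and |x⟩ ↦ |Bx⟩ to the two copies, and XOR-merging the results implements |x⟩ ↦ |(A+B)x⟩. -/
open Matrix Kronecker

noncomputable def P {m n : ℕ} (A : Matrix (Fin m) (Fin n) (ZMod 2)) :
    Matrix (Fin m → ZMod 2) (Fin n → ZMod 2) ℂ :=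
  fun y x => if A.mulVec x = y then 1 else 0

/-- The copy map (green 1→2 spider): `Δ n (y,z) x = 1` iff `y = x` and `z = x`. -/
noncomputable def Δ (n : ℕ) :
    Matrix ((Fin n → ZMod 2) × (Fin n → ZMod 2)) (Fin n → ZMod 2) ℂ :=
  fun yz x => if yz.1 = x ∧ yz.2 = x then 1 else 0

/-- The XOR merge map (red 2→1 spider): `Merge n z (x,y) = 1` iff `z = x + y`. -/
noncomputable def Merge (n : ℕ) :
    Matrix (Fin n → ZMod 2) ((Fin n → ZMod 2) × (Fin n → ZMod 2)) ℂ :=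
  fun z xy => if z = xy.1 + xy.2 then 1 else 0

theorem P_add (n m : ℕ) (A B : Matrix (Fin m) (Fin n) (ZMod 2)) :
    Merge m * (P A ⊗ₖ P B) * Δ n = P (A + B) := by
  ext z x
  rw [Matrix.mul_assoc, Matrix.mul_apply, Finset.sum_eq_single (A.mulVec x, B.mulVec x)]
  · rw [Matrix.mul_apply, Finset.sum_eq_single (x, x)]
    · simp [Merge, P, Δ, Matrix.add_mulVec, eq_comm]
    · rintro ⟨u, v⟩ - h
      have : ¬(u = x ∧ v = x) := fun h' => h (Prod.ext h'.1 h'.2)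
      simp [Δ, this]
    · simp
  · rintro ⟨u, v⟩ - h
    rw [Matrix.mul_apply, Finset.sum_eq_zero, mul_zero]
    rintro ⟨s, t⟩ -
    by_cases hst : s = x ∧ t = x
    · obtain ⟨hs, ht⟩ := hst
      subst s t
      have : ¬(A.mulVec x = u ∧ B.mulVec x = v) := fun h' => h (Prod.ext h'.1.symm h'.2.symm)
      simp only [P, Δ, Matrix.kroneckerMap_apply]
      grind
    · simp [Δ, hst]
  · simp
end

section
/- Matrices are copied by green nodes (Lemma 4.3, copy part): for all natural numbers n, m and every matrix A over ZMod 2 of size m×n, Δ m * P A = (P A ⊗ₖ P A) * Δ n. -/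
open Matrix Kronecker

theorem P_copy (n m : ℕ) (A : Matrix (Fin m) (Fin n) (ZMod 2)) :
    Δ m * P A = (P A ⊗ₖ P A) * Δ n := by
  ext ⟨y, z⟩ x
  have hl : (Δ m * P A) (y, z) x = Δ m (y, z) (A.mulVec x) * P A (A.mulVec x) x := by
    rw [Matrix.mul_apply]
    exact Finset.sum_eq_single _ (fun w _ hw => by simp [P, hw.symm]) (by simp)
  have hr : ((P A ⊗ₖ P A) * Δ n) (y, z) x = (P A ⊗ₖ P A) (y, z) (x, x) * Δ n (x, x) x := by
    rw [Matrix.mul_apply]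
    refine Finset.sum_eq_single _ (fun w _ hw => ?_) (by simp)
    have hw' : ¬(w.1 = x ∧ w.2 = x) := fun h => hw (Prod.ext h.1 h.2)
    simp [Δ, hw']
  rw [hl, hr, kroneckerMap_apply]
  simp [Δ, P, ite_and, eq_comm (a := y), eq_comm (a := z)]
  split_ifs <;> rfl
end

section
/- Matrices are cocopied and coerased by red nodes (Lemma 4.5): for all natural numbers n, m and every matrix A over ZMod 2 of size m×n, (1) P A * M n = M m * (P A ⊗ₖ P A), and (2) P A applied to the unnormalized uniform X-unit vector satisfies: the matrix-vector product of P A with the vector 2^{n/2}·e₀ (where e₀ is the basis vector at 0 ∈ Fin n → ZMod 2) equals 2^{(n-m)/2} times the vector 2^{m/2}·e₀ at 0 ∈ Fin m → ZMod 2. -/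
open Matrix Kronecker

/-- The vector `2^{n/2} · e₀`, where `e₀` is the basis vector at `0 : Fin n → ZMod 2`:
the interpretation of the red 0→1 spider on an `n`-qubit register. -/
noncomputable def xUnit (n : ℕ) : (Fin n → ZMod 2) → ℂ :=
  fun x => (Real.sqrt 2 : ℂ) ^ n * (if x = 0 then 1 else 0)

lemma P_mul_Merge_apply {n m : ℕ} (A : Matrix (Fin m) (Fin n) (ZMod 2))
    (z : Fin m → ZMod 2) (a b : Fin n → ZMod 2) :
    (P A * Merge n) z (a, b) = if A.mulVec a + A.mulVec b = z then 1 else 0 := by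
  simp [Matrix.mul_apply, P, Merge, Matrix.mulVec_add]

lemma Merge_mul_kronecker_P_apply {n m : ℕ} (A : Matrix (Fin m) (Fin n) (ZMod 2))
    (z : Fin m → ZMod 2) (a b : Fin n → ZMod 2) :
    (Merge m * (P A ⊗ₖ P A)) z (a, b) = if z = A.mulVec a + A.mulVec b then 1 else 0 := by
  simp [Matrix.mul_apply, P, Merge, Fintype.sum_prod_type]

lemma P_mulVec_xUnit_apply {n m : ℕ} (A : Matrix (Fin m) (Fin n) (ZMod 2))
    (y : Fin m → ZMod 2) :
    (P A).mulVec (xUnit n) y = (Real.sqrt 2 : ℂ) ^ n * if y = 0 then 1 else 0 := by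
  simp [Matrix.mulVec, dotProduct, P, xUnit, eq_comm]

theorem P_cocopy_coerase (n m : ℕ) (A : Matrix (Fin m) (Fin n) (ZMod 2)) :
    P A * Merge n = Merge m * (P A ⊗ₖ P A) ∧
    (P A).mulVec (xUnit n) = (Real.sqrt 2 : ℂ) ^ ((n : ℤ) - (m : ℤ)) • xUnit m := by
  refine ⟨?_, ?_⟩
  · ext z ⟨a, b⟩
    simp only [P_mul_Merge_apply, Merge_mul_kronecker_P_apply, eq_comm]
  · have h : (Real.sqrt 2 : ℂ) ≠ 0 := by simp
    ext y
    rw [P_mulVec_xUnit_apply, Pi.smul_apply, smul_eq_mul, xUnit, ← mul_assoc,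
      ← zpow_natCast, ← zpow_natCast, ← zpow_add₀ h, sub_add_cancel]
end

section
/- Hadamard conjugation of matrix arrows (Lemma 4.4): for all natural numbers n, m and every matrix A over ZMod 2 of size m×n, H m * P A = 2^{(n-m)/2} • ((P Aᵀ)ᵀ * H n), where Aᵀ is the transpose of A over ZMod 2 and (P Aᵀ)ᵀ is the (complex) transpose of the matrix P (Aᵀ). -/
open Matrix

/-- `χ c = 1` if `c = 0` and `-1` if `c = 1`. -/
noncomputable def χ (c : ZMod 2) : ℂ := if c = 0 then 1 else -1

/-- The `n`-qubit Hadamard transform: `(H n) y x = 2^{-n/2} · (-1)^{⟨x,y⟩}`. -/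
noncomputable def H (n : ℕ) : Matrix (Fin n → ZMod 2) (Fin n → ZMod 2) ℂ :=
  fun y x => (Real.sqrt 2 : ℂ)⁻¹ ^ n * χ (∑ i, x i * y i)

theorem H_mul_P_apply {m n : ℕ} (A : Matrix (Fin m) (Fin n) (ZMod 2))
    (y : Fin m → ZMod 2) (x : Fin n → ZMod 2) :
    (H m * P A) y x = H m y (A *ᵥ x) := by
  simp [Matrix.mul_apply, P]

theorem transpose_P_mul_H_apply {m n : ℕ} (A : Matrix (Fin m) (Fin n) (ZMod 2))
    (y : Fin m → ZMod 2) (x : Fin n → ZMod 2) :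
    ((P Aᵀ)ᵀ * H n) y x = H n (Aᵀ *ᵥ y) x := by
  simp [Matrix.mul_apply, P]

theorem P_hadamard (n m : ℕ) (A : Matrix (Fin m) (Fin n) (ZMod 2)) :
    H m * P A = (Real.sqrt 2 : ℂ) ^ ((n : ℤ) - (m : ℤ)) • ((P Aᵀ)ᵀ * H n) := by
  have hs : (Real.sqrt 2 : ℂ) ≠ 0 := by simp
  ext y x
  have hdot : ∑ i, (A *ᵥ x) i * y i = ∑ i, x i * (Aᵀ *ᵥ y) i := by
    change (A *ᵥ x) ⬝ᵥ y = x ⬝ᵥ (Aᵀ *ᵥ y)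
    rw [Matrix.mulVec_transpose, dotProduct_comm, Matrix.dotProduct_mulVec, dotProduct_comm]
  rw [Matrix.smul_apply, H_mul_P_apply, transpose_P_mul_H_apply, smul_eq_mul, H, H, hdot,
    zpow_sub₀ hs, zpow_natCast, zpow_natCast, inv_pow, inv_pow]
  field_simp
end

section
/- Pauli-X vectors push through matrix arrows (Lemma 4.7, first part): for all natural numbers n, m, every matrix A over ZMod 2 of size m×n and every vector v : Fin n → ZMod 2, P A * X v = X (A.mulVec v) * P A. -/
open Matrix

/-- The Pauli-X-string permutation matrix: `(X v) y x = 1` iff `y = x + v`. -/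
noncomputable def X {n : ℕ} (v : Fin n → ZMod 2) :
    Matrix (Fin n → ZMod 2) (Fin n → ZMod 2) ℂ :=
  fun y x => if y = x + v then 1 else 0

theorem P_pushX (n m : ℕ) (A : Matrix (Fin m) (Fin n) (ZMod 2)) (v : Fin n → ZMod 2) :
    P A * X v = X (A.mulVec v) * P A := by
  ext y x
  simp [Matrix.mul_apply, P, X, Matrix.mulVec_add, eq_comm]
end

section
/- Pauli-Z vectors push through matrix arrows (Lemma 4.7, second part): for all natural numbers n, m, every matrix A over ZMod 2 of size m×n and every vector u : Fin m → ZMod 2, Z u * P A = P A * Z (Aᵀ.mulVec u), where Aᵀ is the transpose of A over ZMod 2. -/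
open Matrix

/-- The diagonal Pauli-Z-string matrix: `(Z u) x x = (-1)^{⟨u,x⟩}`, off-diagonal `0`. -/
noncomputable def Z {n : ℕ} (u : Fin n → ZMod 2) :
    Matrix (Fin n → ZMod 2) (Fin n → ZMod 2) ℂ :=
  fun y x => if y = x then χ (∑ i, u i * x i) else 0

theorem P_pushZ (n m : ℕ) (A : Matrix (Fin m) (Fin n) (ZMod 2)) (u : Fin m → ZMod 2) :
    Z u * P A = P A * Z (Aᵀ.mulVec u) := by
  ext y x
  rw [Matrix.mul_apply, Matrix.mul_apply,
    Finset.sum_eq_single y (fun b _ hb => by simp [Z, hb.symm]) (by simp),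
    Finset.sum_eq_single x (fun b _ hb => by simp [Z, hb]) (by simp)]
  by_cases h : A.mulVec x = y
  · subst h
    have pairing : ∑ i, u i * A.mulVec x i = ∑ i, Aᵀ.mulVec u i * x i := by
      change u ⬝ᵥ A.mulVec x = Aᵀ.mulVec u ⬝ᵥ x
      rw [Matrix.dotProduct_mulVec, Matrix.mulVec_transpose]
    simp [Z, P, pairing]
  · simp [P, h]
end

section
/- Characterization of injective binary matrices (semantic content of Lemma 4.8): for all natural numbers n, m and every matrix A over ZMod 2 of size m×n, the linear map x ↦ A.mulVec x on (Fin n → ZMod 2) is injective if and only if (P A)ᵀ * P A = 1 (the identity matrix indexed by Fin n → ZMod 2). -/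
open Matrix

theorem P_transpose_mul_P_apply {m n : ℕ} (A : Matrix (Fin m) (Fin n) (ZMod 2))
    (x x' : Fin n → ZMod 2) :
    ((P A)ᵀ * P A) x x' = if A.mulVec x = A.mulVec x' then 1 else 0 := by
  simp [Matrix.mul_apply, P, eq_comm]

theorem P_injective_iff (n m : ℕ) (A : Matrix (Fin m) (Fin n) (ZMod 2)) :
    Function.Injective (fun x : Fin n → ZMod 2 => A.mulVec x) ↔ (P A)ᵀ * P A = 1 := by
  refine ⟨fun h => ?_, fun h x x' hxx' => ?_⟩
  · ext x x'
    rw [P_transpose_mul_P_apply, Matrix.one_apply]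
    exact if_congr h.eq_iff rfl rfl
  · by_contra hne
    have hentry := congrFun (congrFun h x) x'
    rw [P_transpose_mul_P_apply, if_pos hxx', Matrix.one_apply_ne hne] at hentry
    exact one_ne_zero hentry
end

section
/- Characterization of surjective binary matrices (semantic content of Lemma 4.9): for all natural numbers n, m and every matrix A over ZMod 2 of size m×n, the map x ↦ A.mulVec x from (Fin n → ZMod 2) to (Fin m → ZMod 2) is surjective if and only if P A * (P A)ᵀ = 2^(n-m) • 1, where 1 is the identity matrix indexed by Fin m → ZMod 2 and 2^(n-m) is computed in ℂ (so n ≥ m is forced when the equality holds). -/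
open Matrix

theorem P_mul_transpose_apply {m n : ℕ} (A : Matrix (Fin m) (Fin n) (ZMod 2))
    (y z : Fin m → ZMod 2) :
    (P A * (P A)ᵀ) y z =
      if y = z then ((Finset.univ.filter fun x => A.mulVec x = y).card : ℂ) else 0 := by
  simp only [Matrix.mul_apply, Matrix.transpose_apply, P]
  split_ifs with h
  · subst h
    simp [← ite_and]
  · refine Finset.sum_eq_zero fun x _ => ?_
    by_cases hy : A.mulVec x = y
    · simp [hy, h]
    · simp [hy]

theorem two_pow_mul_card_fiber {m n : ℕ} {A : Matrix (Fin m) (Fin n) (ZMod 2)}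
    (hA : Function.Surjective fun x : Fin n → ZMod 2 => A.mulVec x) (y : Fin m → ZMod 2) :
    2 ^ m * (Finset.univ.filter fun x => A.mulVec x = y).card = 2 ^ n := by
  have hfiber (z : Fin m → ZMod 2) :
      (Finset.univ.filter fun x => A.mulVec x = z).card =
        (Finset.univ.filter fun x => A.mulVec x = y).card :=
    AddMonoidHom.card_fiber_eq_of_mem_range A.mulVecLin.toAddMonoidHom (hA z) (hA y)
  have hsum := Finset.card_eq_sum_card_fiberwise (s := Finset.univ) (t := Finset.univ)
    (f := fun x : Fin n → ZMod 2 => A.mulVec x) fun _ _ => Finset.mem_coe.2 (Finset.mem_univ _)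
  simpa [hfiber, ZMod.card] using hsum.symm

theorem P_surjective_iff (n m : ℕ) (A : Matrix (Fin m) (Fin n) (ZMod 2)) :
    Function.Surjective (fun x : Fin n → ZMod 2 => A.mulVec x) ↔
      P A * (P A)ᵀ = ((2 : ℂ) ^ ((n : ℤ) - (m : ℤ))) • 1 := by
  constructor
  · intro hA
    ext y z
    rw [P_mul_transpose_apply, Matrix.smul_apply, Matrix.one_apply]
    split_ifs
    · have h : (2 : ℂ) ^ m * ((Finset.univ.filter fun x => A.mulVec x = y).card : ℂ) = 2 ^ n :=
        mod_cast two_pow_mul_card_fiber hA y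
      rw [zpow_sub₀ two_ne_zero, zpow_natCast, zpow_natCast, ← h]
      simp
    · simp
  · intro h y
    have hy := congrFun (congrFun h y) y
    rw [P_mul_transpose_apply, if_pos rfl, Matrix.smul_apply, Matrix.one_apply_eq, smul_eq_mul,
      mul_one] at hy
    have hcard : (Finset.univ.filter fun x => A.mulVec x = y).card ≠ 0 := by
      intro h0
      rw [h0, Nat.cast_zero] at hy
      exact zpow_ne_zero _ two_ne_zero hy.symm
    obtain ⟨x, hx⟩ := Finset.card_ne_zero.1 hcard
    exact ⟨x, (Finset.mem_filter.1 hx).2⟩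
end

section
/- Universality (semantic content of Theorem 3.2): let 𝒞 be the smallest family of complex matrices, containing for each pair of natural numbers (n, m) a set of matrices of size 2^m × 2^n, such that 𝒞 contains: for all n, m ∈ ℕ and all α ∈ ℝ the Z-spider matrix |0^m⟩⟨0^n| + e^{iα}|1^m⟩⟨1^n| (of size 2^m × 2^n, where |0^k⟩ and |1^k⟩ are the all-zeros and all-ones computational basis vectors of k qubits); the 2×2 Hadamard matrix (1/√2)·[[1,1],[1,-1]]; the 2×2 identity; the 4×4 swap matrix sending |xy⟩ to |yx⟩; the cup column vector |00⟩ + |11⟩ (size 4×1); the cap row vector ⟨00| + ⟨11| (size 1×4); and the 1×1 matrix [1]; and such that 𝒞 is closed under matrix multiplication of composable members (a 2^m × 2^k matrix times a 2^k × 2^n matrix) and under Kronecker product. Then for all n, m ∈ ℕ, every complex matrix of size 2^m × 2^n belongs to 𝒞. -/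
open Matrix Kronecker

/-- Reindexing equivalence: bit strings of length `m + p` correspond to pairs of
bit strings of lengths `m` and `p`. -/
def splitEquiv (m p : ℕ) :
    (Fin (m + p) → ZMod 2) ≃ (Fin m → ZMod 2) × (Fin p → ZMod 2) :=
  (Equiv.arrowCongr finSumFinEquiv.symm (Equiv.refl (ZMod 2))).trans
    (Equiv.sumArrowEquivProdArrow _ _ _)

/-- The smallest family of complex matrices (of sizes `2^m × 2^n`, with rows and
columns indexed by bit strings) containing the Z-spiders, the Hadamard matrix,
the identity, the swap, cup, cap and the scalar `[1]`, and closed under matrix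
multiplication of composable members and under Kronecker product. -/
inductive ZXRep : (n m : ℕ) → Matrix (Fin m → ZMod 2) (Fin n → ZMod 2) ℂ → Prop
  | zspider (n m : ℕ) (α : ℝ) :
      ZXRep n m (fun y x =>
        (if y = 0 ∧ x = 0 then 1 else 0) +
          Complex.exp (α * Complex.I) * (if y = 1 ∧ x = 1 then 1 else 0))
  | hadamard :
      ZXRep 1 1 (fun y x =>
        (Real.sqrt 2 : ℂ)⁻¹ * (if y 0 = 1 ∧ x 0 = 1 then -1 else 1))
  | id : ZXRep 1 1 (fun y x => if y = x then 1 else 0)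
  | swap : ZXRep 2 2 (fun y x => if y 0 = x 1 ∧ y 1 = x 0 then 1 else 0)
  | cup : ZXRep 0 2 (fun y _ => if y 0 = y 1 then 1 else 0)
  | cap : ZXRep 2 0 (fun _ x => if x 0 = x 1 then 1 else 0)
  | one : ZXRep 0 0 (fun _ _ => 1)
  | comp {n k m : ℕ} {M₁ : Matrix (Fin m → ZMod 2) (Fin k → ZMod 2) ℂ}
      {M₂ : Matrix (Fin k → ZMod 2) (Fin n → ZMod 2) ℂ} :
      ZXRep k m M₁ → ZXRep n k M₂ → ZXRep n m (M₁ * M₂)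
  | tensor {n m q p : ℕ} {M : Matrix (Fin m → ZMod 2) (Fin n → ZMod 2) ℂ}
      {N : Matrix (Fin p → ZMod 2) (Fin q → ZMod 2) ℂ} :
      ZXRep n m M → ZXRep q p N →
      ZXRep (n + q) (m + p)
        (Matrix.reindex (splitEquiv m p).symm (splitEquiv n q).symm (M ⊗ₖ N))

namespace ZXRep

theorem congr {n m : ℕ} {M N : Matrix (Fin m → ZMod 2) (Fin n → ZMod 2) ℂ}
    (h : ZXRep n m M) (e : ∀ y x, M y x = N y x) : ZXRep n m N := by
  have : M = N := by ext y x; exact e y x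
  exact this ▸ h

theorem comp_sum {n k m : ℕ} {M : Matrix (Fin m → ZMod 2) (Fin k → ZMod 2) ℂ}
    {N : Matrix (Fin k → ZMod 2) (Fin n → ZMod 2) ℂ} (hM : ZXRep k m M) (hN : ZXRep n k N) :
    ZXRep n m (fun y x => ∑ z, M y z * N z x) :=
  (comp hM hN).congr fun _ _ => Matrix.mul_apply

/-- The Kronecker product, in terms of the two blocks of the index strings. -/
theorem kron {n m q p : ℕ} {M : Matrix (Fin m → ZMod 2) (Fin n → ZMod 2) ℂ}
    {N : Matrix (Fin p → ZMod 2) (Fin q → ZMod 2) ℂ} (hM : ZXRep n m M) (hN : ZXRep q p N) :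
    ZXRep (n + q) (m + p) (fun y x =>
      M (y ∘ Fin.castAdd p) (x ∘ Fin.castAdd q) * N (y ∘ Fin.natAdd m) (x ∘ Fin.natAdd n)) :=
  (tensor hM hN).congr fun _ _ => rfl

end ZXRep

theorem bit_cases (b : ZMod 2) : b = 0 ∨ b = 1 := by
  revert b; decide

/-- The matrix of the linear map sending `f` to `y ↦ f (y ∘ σ)`. -/
def pullMatrix {k l : ℕ} (σ : Fin k → Fin l) :
    Matrix (Fin l → ZMod 2) (Fin k → ZMod 2) ℂ :=
  fun y x => if y ∘ σ = x then 1 else 0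

theorem pullMatrix_mul {k l m : ℕ} (σ : Fin k → Fin l)
    (M : Matrix (Fin k → ZMod 2) (Fin m → ZMod 2) ℂ) (y : Fin l → ZMod 2) (x : Fin m → ZMod 2) :
    (pullMatrix σ * M) y x = M (y ∘ σ) x := by
  simp [Matrix.mul_apply, pullMatrix]

namespace ZXRep

theorem pull_comp {k l m : ℕ} {σ : Fin l → Fin m} {τ : Fin k → Fin l}
    (hσ : ZXRep l m (pullMatrix σ)) (hτ : ZXRep k l (pullMatrix τ)) :
    ZXRep k m (pullMatrix (σ ∘ τ)) :=
  (comp hσ hτ).congr fun y x => by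
    rw [pullMatrix_mul]; rfl

theorem pull_sum {k l k' l' : ℕ} {σ : Fin k → Fin l} {τ : Fin k' → Fin l'}
    (hσ : ZXRep k l (pullMatrix σ)) (hτ : ZXRep k' l' (pullMatrix τ)) :
    ZXRep (k + k') (l + l')
      (pullMatrix (Fin.append (Fin.castAdd l' ∘ σ) (Fin.natAdd l ∘ τ))) :=
  (kron hσ hτ).congr fun y x => by
    simp only [pullMatrix, ← ite_and, mul_ite, mul_one, mul_zero]
    refine if_congr ?_ rfl rfl
    simp only [funext_iff, Fin.forall_fin_add, Function.comp_apply, Fin.append_left,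
      Fin.append_right]
    tauto

theorem pull_fold : ZXRep 2 1 (pullMatrix fun _ => 0) :=
  (zspider 2 1 0).congr fun y x => by
    simp only [pullMatrix, funext_iff, Fin.forall_fin_succ, Function.comp_apply]
    rcases bit_cases (y 0) with h | h <;> rcases bit_cases (x 0) with h' | h' <;>
      rcases bit_cases (x 1) with h'' | h'' <;> simp [h, h', h'']

theorem pull_one : ZXRep 1 1 (pullMatrix _root_.id) :=
  id.congr fun _ _ => rfl

theorem pull_swap : ZXRep 2 2 (pullMatrix ![1, 0]) :=
  swap.congr fun y x => by
    simp [pullMatrix, funext_iff, Fin.forall_fin_succ, and_comm]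

theorem pull_id (k : ℕ) : ZXRep k k (pullMatrix _root_.id) := by
  induction k with
  | zero => exact one.congr fun y x => (if_pos (Subsingleton.elim _ _)).symm
  | succ k ih =>
    convert pull_sum ih pull_one using 2
    ext i
    refine Fin.addCases (fun i => ?_) (fun i => ?_) i <;> simp

theorem pull_empty (l : ℕ) (σ : Fin 0 → Fin l) : ZXRep 0 l (pullMatrix σ) := by
  induction l with
  | zero => convert pull_id 0
  | succ l ih =>
    have h : ZXRep 0 1 (pullMatrix Fin.elim0) := (zspider 0 1 0).congr fun y x => by
      simp only [pullMatrix, funext_iff, Fin.forall_fin_succ]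
      rcases bit_cases (y 0) with h | h <;> simp [h]
    convert pull_sum (ih Fin.elim0) h using 2

theorem pull_append_id {l : ℕ} (i : Fin l) :
    ZXRep (l + 1) l (pullMatrix (Fin.append _root_.id fun _ : Fin 1 => i)) := by
  induction l with
  | zero => exact i.elim0
  | succ l ih =>
    have cast_eq (j : Fin l) : Fin.castAdd 2 j = Fin.castAdd 1 (Fin.castAdd 1 j) := rfl
    induction i using Fin.lastCases with
    | last =>
      convert pull_sum (pull_id l) pull_fold using 2
      ext j : 1
      refine Fin.addCases (m := l) (n := 2) (fun j => ?_) (fun j => ?_) j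
      · rw [Fin.append_left, cast_eq, Fin.append_left]
        rfl
      · rw [Fin.append_right]
        fin_cases j
        · exact Fin.append_left _ _ (Fin.last l)
        · exact Fin.append_right _ _ 0
    | cast i =>
      have hs := pull_sum (pull_id l) pull_swap
      convert pull_comp (pull_sum (ih i) pull_one) hs using 2
      ext j : 1
      refine Fin.addCases (m := l) (n := 2) (fun j => ?_) (fun j => ?_) j
      · rw [Function.comp_apply, Fin.append_left, cast_eq, Fin.append_left]
        refine Eq.trans ?_ (Fin.append_left (m := l + 1) (n := 1) _ _ (Fin.castAdd 1 j)).symm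
        exact congrArg (Fin.castAdd 1) (Fin.append_left _root_.id (fun _ : Fin 1 => i) j).symm
      · rw [Function.comp_apply, Fin.append_right]
        fin_cases j
        · refine (Fin.append_left _ _ (Fin.last l)).trans ?_
          refine Eq.trans ?_ (Fin.append_right (m := l + 1) (n := 1) _ _ 0).symm
          rfl
        · refine (Fin.append_right _ _ 0).trans (Eq.symm ?_)
          refine (Fin.append_left (m := l + 1) (n := 1) _ _ (Fin.last l)).trans ?_
          exact congrArg (Fin.castAdd 1) (Fin.append_right _ _ 0)

theorem pull {k l : ℕ} (σ : Fin k → Fin l) : ZXRep k l (pullMatrix σ) := by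
  induction k with
  | zero => exact pull_empty l σ
  | succ k ih =>
    convert pull_comp (pull_append_id (σ (Fin.last k)))
      (pull_sum (ih (σ ∘ Fin.castSucc)) pull_one) using 2
    ext j : 1
    refine Fin.addCases (m := k) (n := 1) (fun j => ?_) (fun j => ?_) j
    · rw [Function.comp_apply, Fin.append_left]
      refine Eq.trans ?_ (Fin.append_left (m := l) (n := 1) _ _ (σ j.castSucc)).symm
      rfl
    · rw [Function.comp_apply, Fin.append_right, Fin.fin_one_eq_zero j]
      refine Eq.trans ?_ (Fin.append_right (m := l) (n := 1) _ _ 0).symm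
      rfl

/-- Discarding the last `n` wires. -/
theorem discard (m n : ℕ) :
    ZXRep (m + n) m (fun y x => if y = x ∘ Fin.castAdd n then 1 else 0) := by
  induction n with
  | zero => exact (pull_id m).congr fun _ _ => rfl
  | succ n ih =>
    have h : ZXRep 1 0 (fun _ _ => 1) := (zspider 1 0 0).congr fun y x => by
      simp only [funext_iff, Fin.forall_fin_succ]
      rcases bit_cases (x 0) with h | h <;> simp [h]
    have h' := kron (pull_id (m + n)) h
    refine (comp_sum ih h').congr fun y x => ?_
    have hz (z : Fin (m + n) → ZMod 2) : z ∘ Fin.castAdd 0 = z := rfl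
    simp only [pullMatrix, Function.comp_id, mul_one, mul_ite, mul_zero, hz]
    simp
    rfl

end ZXRep

/-- `f` is the amplitude function of a column vector on `k` wires in the family `ZXRep`. -/
def ZXState (k : ℕ) (f : (Fin k → ZMod 2) → ℂ) : Prop :=
  ZXRep 0 k fun y _ => f y

/-- The graph of the Boolean function `g` is the support of a vector in the family `ZXRep`. -/
def ZXGraph (k : ℕ) (g : (Fin k → ZMod 2) → ZMod 2) : Prop :=
  ZXState (k + 1) fun y => if y (Fin.natAdd k 0) = g (y ∘ Fin.castAdd 1) then 1 else 0

theorem append_comp_castAdd {k r : ℕ} {α : Type*} (x : Fin k → α) (z : Fin r → α) :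
    Fin.append x z ∘ Fin.castAdd r = x :=
  funext fun i => Fin.append_left x z i

theorem append_comp_natAdd {k r : ℕ} {α : Type*} (x : Fin k → α) (z : Fin r → α) :
    Fin.append x z ∘ Fin.natAdd k = z :=
  funext fun i => Fin.append_right x z i

theorem append_comp_castAdd_natAdd {k r : ℕ} {α : Type*} (y : Fin (k + r) → α) :
    Fin.append (y ∘ Fin.castAdd r) (y ∘ Fin.natAdd k) = y :=
  funext fun i => by refine Fin.addCases (fun i => ?_) (fun i => ?_) i <;> simp

theorem sum_append {k r : ℕ} (f : (Fin (k + r) → ZMod 2) → ℂ) :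
    ∑ y, f y = ∑ x : Fin k → ZMod 2, ∑ z : Fin r → ZMod 2, f (Fin.append x z) := by
  rw [← Fintype.sum_prod_type']
  exact (Fintype.sum_equiv (Fin.appendEquiv k r) _ _ fun _ => rfl).symm

namespace ZXState

variable {k l r : ℕ} {f g : (Fin k → ZMod 2) → ℂ}

theorem congr (h : ZXState k f) (e : ∀ y, f y = g y) : ZXState k g :=
  (funext e : f = g) ▸ h

theorem subst (h : ZXState k f) (σ : Fin k → Fin l) : ZXState l fun y => f (y ∘ σ) :=
  (ZXRep.comp (ZXRep.pull σ) h).congr fun y x => pullMatrix_mul σ _ y x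

theorem mul (hf : ZXState k f) (hg : ZXState k g) : ZXState k fun y => f y * g y := by
  have h : ZXState (k + k) fun y => f (y ∘ Fin.castAdd k) * g (y ∘ Fin.natAdd k) :=
    ZXRep.kron hf hg
  refine (h.subst (Fin.append _root_.id _root_.id)).congr fun y => ?_
  rw [Function.comp_assoc, Function.comp_assoc, append_comp_castAdd, append_comp_natAdd]
  rfl

theorem one (k : ℕ) : ZXState k fun _ => 1 :=
  (ZXRep.pull_empty k Fin.elim0).congr fun _ _ => if_pos (Subsingleton.elim _ _)

theorem prod {ι : Type*} (s : Finset ι) {f : ι → (Fin k → ZMod 2) → ℂ}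
    (h : ∀ i, ZXState k (f i)) : ZXState k fun y => ∏ i ∈ s, f i y := by
  classical
  induction s using Finset.induction_on with
  | empty => exact (one k).congr fun y => by simp
  | insert i s hi ih => exact ((h i).mul ih).congr fun y => by simp [hi]

theorem sum {f : (Fin (k + r) → ZMod 2) → ℂ} (h : ZXState (k + r) f) :
    ZXState k fun x => ∑ z, f (Fin.append x z) :=
  (ZXRep.comp_sum (ZXRep.discard k r) h).congr fun y _ => by
    rw [sum_append, Finset.sum_eq_single y]
    · simp [append_comp_castAdd]
    · intro b _ hb
      simp [append_comp_castAdd, hb.symm]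
    · simp

theorem sum_bit (F : (Fin k → ZMod 2) → ZMod 2 → ℂ)
    (h : ZXState (k + 1) fun y => F (y ∘ Fin.castAdd 1) (y (Fin.natAdd k 0))) :
    ZXState k fun x => F x 0 + F x 1 := by
  refine h.sum.congr fun x => ?_
  simp only [append_comp_castAdd, Fin.append_right]
  exact (Fintype.sum_equiv (Equiv.funUnique (Fin 1) (ZMod 2)) _ (F x) fun _ => rfl).trans
    (Fin.sum_univ_two _)

theorem comp {f : (Fin r → ZMod 2) → ℂ} {g : Fin r → (Fin k → ZMod 2) → ZMod 2}
    (hf : ZXState r f) (hg : ∀ i, ZXGraph k (g i)) : ZXState k fun x => f fun i => g i x := by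
  have h (i : Fin r) : ZXState (k + r) fun y =>
      if y (Fin.natAdd k i) = g i (y ∘ Fin.castAdd r) then 1 else 0 := by
    refine (ZXState.subst (hg i) (Fin.append (Fin.castAdd r) fun _ => Fin.natAdd k i)).congr
      fun y => ?_
    rw [Function.comp_assoc, append_comp_castAdd, Function.comp_apply, Fin.append_right]
  refine ((prod Finset.univ h).mul (hf.subst (Fin.natAdd k))).sum.congr fun x => ?_
  rw [Finset.sum_eq_single fun i => g i x]
  · simp [append_comp_castAdd, append_comp_natAdd]
  · intro z _ hz
    obtain ⟨i, hi⟩ := Function.ne_iff.1 hz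
    rw [Finset.prod_eq_zero (Finset.mem_univ i), zero_mul]
    simp [append_comp_castAdd, hi]
  · simp

end ZXState

namespace ZXGraph

variable {k l r : ℕ}

theorem subst {g : (Fin k → ZMod 2) → ZMod 2} (h : ZXGraph k g) (σ : Fin k → Fin l) :
    ZXGraph l fun y => g (y ∘ σ) := by
  refine (ZXState.subst h (Fin.append (Fin.castAdd 1 ∘ σ) fun _ => Fin.natAdd l 0)).congr
    fun y => ?_
  rw [Function.comp_assoc, append_comp_castAdd, Function.comp_apply, Fin.append_right]
  rfl

theorem coord (i : Fin k) : ZXGraph k fun x => x i := by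
  have h : ZXState 2 fun y => if y 0 = y 1 then 1 else 0 := ZXRep.cup
  exact h.subst ![Fin.natAdd k 0, Fin.castAdd 1 i]

theorem comp {f : (Fin r → ZMod 2) → ZMod 2} {g : Fin r → (Fin k → ZMod 2) → ZMod 2}
    (hf : ZXGraph r f) (hg : ∀ i, ZXGraph k (g i)) : ZXGraph k fun x => f fun i => g i x := by
  have h (i : Fin (r + 1)) : ZXGraph (k + 1) (Fin.append (fun i y => g i (y ∘ Fin.castAdd 1))
      (fun (_ : Fin 1) y => y (Fin.natAdd k 0)) i) := by
    refine Fin.addCases (fun i => ?_) (fun i => ?_) i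
    · rw [Fin.append_left]
      exact (hg i).subst _
    · rw [Fin.append_right]
      exact coord _
  refine (ZXState.comp hf h).congr fun y => ?_
  simp only [Fin.append_right, Function.comp_def, Fin.append_left]

end ZXGraph

theorem bit_one_add_one : (1 : ZMod 2) + 1 = 0 := rfl

/-- The vector on one wire with amplitudes `1` and `t`. -/
def ZXWeight (t : ℂ) : Prop :=
  ZXState 1 fun y => if y 0 = 1 then t else 1

theorem ZXWeight.phase (α : ℝ) : ZXWeight (Complex.exp (α * Complex.I)) :=
  (ZXRep.zspider 0 1 α).congr fun y x => by
    simp only [funext_iff, Fin.forall_fin_succ]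
    rcases bit_cases (y 0) with h | h <;> simp [h]

theorem ZXWeight.mul {s t : ℂ} (hs : ZXWeight s) (ht : ZXWeight t) : ZXWeight (s * t) :=
  (ZXState.mul hs ht).congr fun y => by split_ifs <;> simp

theorem ZXWeight.one : ZXWeight 1 := by
  simpa using ZXWeight.phase 0

theorem ZXWeight.neg_one : ZXWeight (-1) := by
  simpa using ZXWeight.phase Real.pi

namespace ZXState

theorem scalar {c : ℂ} (h : ZXState 0 fun _ => c) (k : ℕ) : ZXState k fun _ => c :=
  h.subst Fin.elim0

theorem hadamard :
    ZXState 2 fun y => (Real.sqrt 2 : ℂ)⁻¹ * (if y 0 = 1 ∧ y 1 = 1 then -1 else 1) := by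
  have h := ZXRep.comp_sum (ZXRep.kron ZXRep.id ZXRep.hadamard) ZXRep.cup
  refine ZXRep.congr h fun y x => ?_
  refine (Finset.sum_eq_single (fun _ : Fin 2 => y 0) ?_ ?_).trans ?_
  · intro z _ hz
    by_cases h₀ : y 0 = z 0
    · by_cases h₁ : z 0 = z 1
      · refine absurd (funext fun i => ?_) hz
        fin_cases i
        · exact h₀.symm
        · exact h₁.symm.trans h₀.symm
      · exact mul_eq_zero_of_right _ (if_neg h₁)
    · refine mul_eq_zero_of_left (mul_eq_zero_of_left (if_neg fun e => h₀ ?_) _) _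
      exact congrFun e 0
  · simp
  · rw [if_pos rfl, mul_one, if_pos (funext fun i => by rw [Fin.fin_one_eq_zero i]; rfl), one_mul]
    refine congrArg _ (if_congr ?_ rfl rfl)
    exact and_comm

theorem scalar_of_weights {a b : ℂ} (ha : ZXWeight a) (hb : ZXWeight b) :
    ZXState 0 fun _ => (Real.sqrt 2 : ℂ)⁻¹ * (1 + a + b - a * b) := by
  have h := (ha.subst fun _ => (0 : Fin 2)).mul ((hb.subst fun _ => (1 : Fin 2)).mul hadamard)
  let F (r s : ZMod 2) : ℂ := (if r = 1 then a else 1) *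
    ((if s = 1 then b else 1) * ((Real.sqrt 2 : ℂ)⁻¹ * if r = 1 ∧ s = 1 then -1 else 1))
  have h' : ZXState 1 fun x => F (x 0) 0 + F (x 0) 1 := sum_bit (fun x s => F (x 0) s) h
  refine (sum_bit (k := 0) (fun _ r => F r 0 + F r 1) h').congr fun _ => ?_
  simp [F]
  ring

theorem sqrt_two : ZXState 0 fun _ => (Real.sqrt 2 : ℂ) :=
  (scalar_of_weights .one .one).congr fun _ => by
    have h : (Real.sqrt 2 : ℂ) ^ 2 = 2 := by norm_cast; simp
    have h' : (Real.sqrt 2 : ℂ) ≠ 0 := by simp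
    field_simp
    linear_combination -h

theorem inv_sqrt_two : ZXState 0 fun _ => (Real.sqrt 2 : ℂ)⁻¹ :=
  (scalar_of_weights (.phase (Real.pi / 3)) (.phase (-(Real.pi / 3)))).congr fun _ => by
    have h : Complex.exp ((Real.pi / 3 : ℝ) * Complex.I) +
        Complex.exp ((-(Real.pi / 3) : ℝ) * Complex.I) = 1 := by
      have := Complex.two_cos (Real.pi / 3 : ℝ)
      rw [← Complex.ofReal_cos, Real.cos_pi_div_three] at this
      push_cast at this ⊢
      rw [← this]
      norm_num
    have h' : Complex.exp ((Real.pi / 3 : ℝ) * Complex.I) *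
        Complex.exp ((-(Real.pi / 3) : ℝ) * Complex.I) = 1 := by
      rw [← Complex.exp_add]
      simp
    linear_combination (Real.sqrt 2 : ℂ)⁻¹ * h - (Real.sqrt 2 : ℂ)⁻¹ * h'

theorem half (k : ℕ) : ZXState k fun _ => 2⁻¹ :=
  ((inv_sqrt_two.mul inv_sqrt_two).scalar k).congr fun _ => by
    rw [← mul_inv]
    norm_cast
    simp

theorem controlled_sign : ZXState 2 fun y => if y 0 = 1 ∧ y 1 = 1 then -1 else 1 :=
  ((sqrt_two.scalar 2).mul hadamard).congr fun y => mul_inv_cancel_left₀ (by simp) _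

/-- Fourier inversion on one bit. -/
theorem of_sign {k : ℕ} {g : (Fin k → ZMod 2) → ZMod 2}
    (h : ZXState (k + 1) fun y =>
      if y (Fin.natAdd k 0) = 1 ∧ g (y ∘ Fin.castAdd 1) = 1 then -1 else 1) :
    ZXState k fun x => if g x = 0 then 1 else 0 :=
  ((sum_bit (fun x w => if w = 1 ∧ g x = 1 then -1 else 1) h).mul (half k)).congr fun x => by
    rcases bit_cases (g x) with e | e <;> norm_num [e]

theorem indicator_zero : ZXState 1 fun x => if x 0 = 0 then 1 else 0 :=
  of_sign (k := 1) (g := fun x => x 0) (controlled_sign.subst ![1, 0])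

end ZXState

namespace ZXGraph

theorem one (k : ℕ) : ZXGraph k fun _ => 1 := by
  have h : ZXState 1 fun x => if x 0 + 1 = 0 then 1 else 0 := by
    refine ZXState.of_sign (k := 1) (g := fun x => x 0 + 1) ?_
    refine (ZXState.mul (ZXState.controlled_sign.subst ![1, 0])
      (ZXState.subst ZXWeight.neg_one fun _ => 1)).congr fun y => ?_
    change (if y 1 = 1 ∧ y 0 = 1 then -1 else 1) * (if y 1 = 1 then -1 else 1) =
      if y 1 = 1 ∧ y 0 + 1 = 1 then (-1 : ℂ) else 1
    rcases bit_cases (y 0) with h₀ | h₀ <;> rcases bit_cases (y 1) with h₁ | h₁ <;>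
      simp [h₀, h₁, bit_one_add_one]
  refine (h.subst fun _ => Fin.natAdd k 0).congr fun y => if_congr ?_ rfl rfl
  exact CharTwo.add_eq_zero

theorem add_bits : ZXGraph 2 fun x => x 0 + x 1 := by
  have h : ZXState 3 fun x => if x 0 + x 1 + x 2 = 0 then 1 else 0 := by
    refine ZXState.of_sign (k := 3) (g := fun x => x 0 + x 1 + x 2) ?_
    refine ((ZXState.controlled_sign.subst ![3, 0]).mul
      ((ZXState.controlled_sign.subst ![3, 1]).mul
        (ZXState.controlled_sign.subst ![3, 2]))).congr fun y => ?_
    change (if y 3 = 1 ∧ y 0 = 1 then -1 else 1) * ((if y 3 = 1 ∧ y 1 = 1 then -1 else 1) *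
      (if y 3 = 1 ∧ y 2 = 1 then -1 else 1)) =
        if y 3 = 1 ∧ y 0 + y 1 + y 2 = 1 then (-1 : ℂ) else 1
    rcases bit_cases (y 0) with h₀ | h₀ <;> rcases bit_cases (y 1) with h₁ | h₁ <;>
      rcases bit_cases (y 2) with h₂ | h₂ <;> rcases bit_cases (y 3) with h₃ | h₃ <;>
        simp [h₀, h₁, h₂, h₃, bit_one_add_one]
  refine h.congr fun y => if_congr ?_ rfl rfl
  exact CharTwo.add_eq_zero.trans eq_comm

theorem add {k : ℕ} {f g : (Fin k → ZMod 2) → ZMod 2} (hf : ZXGraph k f) (hg : ZXGraph k g) :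
    ZXGraph k fun x => f x + g x :=
  add_bits.comp (g := ![f, g]) (Fin.forall_fin_two.2 ⟨hf, hg⟩)

theorem weight {k : ℕ} {g : (Fin k → ZMod 2) → ZMod 2} {t : ℂ} (hg : ZXGraph k g)
    (ht : ZXWeight t) : ZXState k fun x => if g x = 1 then t else 1 :=
  ZXState.comp ht fun _ => hg

end ZXGraph

theorem ZXState.doubly_controlled_sign :
    ZXState 3 fun y => if y 0 = 1 ∧ y 1 * y 2 = 1 then -1 else 1 := by
  have hω : ZXWeight (Complex.exp ((Real.pi / 4 : ℝ) * Complex.I)) := .phase _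
  have hω' : ZXWeight (Complex.exp ((-(Real.pi / 4) : ℝ) * Complex.I)) := .phase _
  have e : Complex.exp ((Real.pi / 4 : ℝ) * Complex.I) *
      Complex.exp ((-(Real.pi / 4) : ℝ) * Complex.I) = 1 := by
    rw [← Complex.exp_add]
    simp
  have e' : Complex.exp ((Real.pi / 4 : ℝ) * Complex.I) ^ 4 = -1 := by
    rw [← Complex.exp_nat_mul, ← Complex.exp_pi_mul_I]
    congr 1
    push_cast
    ring
  generalize Complex.exp ((Real.pi / 4 : ℝ) * Complex.I) = ω at *
  generalize Complex.exp ((-(Real.pi / 4) : ℝ) * Complex.I) = ω' at *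
  have a (i : Fin 3) := ZXGraph.coord i
  refine ((((a 0).weight hω).mul (((a 1).weight hω).mul ((a 2).weight hω))).mul
    (((((a 0).add (a 1)).weight hω').mul ((((a 0).add (a 2)).weight hω').mul
      (((a 1).add (a 2)).weight hω'))).mul
        ((((a 0).add (a 1)).add (a 2)).weight hω))).congr fun y => ?_
  rcases bit_cases (y 0) with h₀ | h₀ <;> rcases bit_cases (y 1) with h₁ | h₁ <;>
    rcases bit_cases (y 2) with h₂ | h₂ <;> simp [h₀, h₁, h₂, bit_one_add_one]
  all_goals grind

namespace ZXGraph

theorem mul_bits : ZXGraph 2 fun x => x 0 * x 1 := by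
  have h : ZXState 3 fun x => if x 0 * x 1 + x 2 = 0 then 1 else 0 := by
    refine ZXState.of_sign (k := 3) (g := fun x => x 0 * x 1 + x 2) ?_
    refine ((ZXState.doubly_controlled_sign.subst ![3, 0, 1]).mul
      (ZXState.controlled_sign.subst ![3, 2])).congr fun y => ?_
    change (if y 3 = 1 ∧ y 0 * y 1 = 1 then -1 else 1) * (if y 3 = 1 ∧ y 2 = 1 then -1 else 1) =
      if y 3 = 1 ∧ y 0 * y 1 + y 2 = 1 then (-1 : ℂ) else 1
    rcases bit_cases (y 0 * y 1) with h₀ | h₀ <;> rcases bit_cases (y 2) with h₂ | h₂ <;>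
      rcases bit_cases (y 3) with h₃ | h₃ <;> simp [h₀, h₂, h₃, bit_one_add_one]
  refine h.congr fun y => if_congr ?_ rfl rfl
  exact CharTwo.add_eq_zero.trans eq_comm

theorem mul {k : ℕ} {f g : (Fin k → ZMod 2) → ZMod 2} (hf : ZXGraph k f) (hg : ZXGraph k g) :
    ZXGraph k fun x => f x * g x :=
  mul_bits.comp (g := ![f, g]) (Fin.forall_fin_two.2 ⟨hf, hg⟩)

theorem const {k : ℕ} (c : ZMod 2) : ZXGraph k fun _ => c := by
  rcases bit_cases c with rfl | rfl
  · exact (one k).add (one k)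
  · exact one k

theorem prod {k : ℕ} {ι : Type*} (s : Finset ι) {g : ι → (Fin k → ZMod 2) → ZMod 2}
    (h : ∀ i, ZXGraph k (g i)) : ZXGraph k fun x => ∏ i ∈ s, g i x := by
  classical
  induction s using Finset.induction_on with
  | empty => simpa using one k
  | insert i s hi ih => simpa [hi] using (h i).mul ih

end ZXGraph

namespace ZXWeight

theorem one_add {t : ℂ} (ht : ZXWeight t) : ZXWeight (1 + t) := by
  have h : ZXGraph 2 fun x => x 1 * (x 0 + 1) :=
    (ZXGraph.coord 1).mul ((ZXGraph.coord 0).add (.one 2))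
  have h' := (ZXState.comp ZXState.indicator_zero fun _ => h).mul ((ZXGraph.coord 1).weight ht)
  refine (ZXState.sum_bit (k := 1) (fun x w => (if w * (x 0 + 1) = 0 then 1 else 0) *
    (if w = 1 then t else 1)) h').congr fun x => ?_
  rcases bit_cases (x 0) with e | e <;> simp [e, bit_one_add_one]

theorem pow {t : ℂ} (ht : ZXWeight t) (n : ℕ) : ZXWeight (t ^ n) := by
  induction n with
  | zero => simpa using one
  | succ n ih => simpa [pow_succ] using ih.mul ht

theorem natCast (n : ℕ) : ZXWeight (n + 1 : ℕ) := by
  induction n with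
  | zero => simpa using one
  | succ n ih => simpa [add_comm] using ih.one_add

theorem real_of_le_one {r : ℝ} (h₀ : 0 ≤ r) (h₁ : r ≤ 1) : ZXWeight r := by
  have e := ((phase (Real.arccos ((r - 2) / 2))).one_add.mul
    (phase (-Real.arccos ((r - 2) / 2))).one_add)
  convert e using 1
  have hc := Complex.two_cos (Real.arccos ((r - 2) / 2) : ℝ)
  rw [← Complex.ofReal_cos, Real.cos_arccos (by linarith) (by linarith)] at hc
  have h' : Complex.exp (Real.arccos ((r - 2) / 2) * Complex.I) *
      Complex.exp (-Real.arccos ((r - 2) / 2) * Complex.I) = 1 := by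
    rw [← Complex.exp_add]
    simp
  push_cast at hc ⊢
  linear_combination hc - h'

theorem real {r : ℝ} (h : 0 ≤ r) : ZXWeight r := by
  obtain ⟨n, hn⟩ := exists_nat_ge r
  have hn' : (0 : ℝ) < (n + 1 : ℕ) := by positivity
  have h' : ZXWeight (r / (n + 1 : ℕ) : ℝ) :=
    real_of_le_one (by positivity) (by rw [div_le_one hn']; push_cast; linarith)
  convert (natCast n).mul h' using 1
  have : ((n + 1 : ℕ) : ℂ) ≠ 0 := by exact_mod_cast hn'.ne'
  rw [Complex.ofReal_div, Complex.ofReal_natCast]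
  field_simp

theorem all (t : ℂ) : ZXWeight t := by
  have h := (real (norm_nonneg t)).mul (phase t.arg)
  rwa [Complex.norm_mul_exp_arg_mul_I] at h

end ZXWeight

theorem ZXState.all {k : ℕ} (f : (Fin k → ZMod 2) → ℂ) : ZXState k f := by
  have h (a : Fin k → ZMod 2) : ZXGraph k fun x => ∏ i, (x i + (a i + 1)) :=
    ZXGraph.prod _ fun i => (ZXGraph.coord i).add (.const _)
  refine (ZXState.prod Finset.univ fun a => (h a).weight (ZXWeight.all (f a))).congr fun x => ?_
  rw [Finset.prod_eq_single x]
  · rw [if_pos]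
    refine Finset.prod_eq_one fun i _ => ?_
    rw [← add_assoc, CharTwo.add_self_eq_zero, zero_add]
  · intro a _ ha
    obtain ⟨i, hi⟩ := Function.ne_iff.1 ha
    rw [if_neg]
    rw [Finset.prod_eq_zero (Finset.mem_univ i)]
    · exact zero_ne_one
    · revert hi
      generalize a i = b
      generalize x i = c
      revert b c
      decide
  · simp

/-- Universality: every `2^m × 2^n` complex matrix belongs to the family. -/
theorem ZX_universal (n m : ℕ) (M : Matrix (Fin m → ZMod 2) (Fin n → ZMod 2) ℂ) :
    ZXRep n m M := by
  have hf : ZXState (m + n) fun z => M (z ∘ Fin.castAdd n) (z ∘ Fin.natAdd m) := ZXState.all _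
  have hN := ZXRep.comp (ZXRep.pull (Fin.append (Fin.natAdd m) _root_.id))
    (ZXRep.kron (ZXRep.pull_id n) hf)
  have hN' : ZXRep n (m + n) fun z x =>
      (if z ∘ Fin.natAdd m = x then 1 else 0) * M (z ∘ Fin.castAdd n) (z ∘ Fin.natAdd m) :=
    ZXRep.congr hN fun z x => (pullMatrix_mul _ _ z x).trans <| by
      simp only [Function.comp_assoc z, append_comp_castAdd, append_comp_natAdd]
      rfl
  refine (ZXRep.comp_sum (ZXRep.discard m n) hN').congr fun y x => ?_
  rw [Finset.sum_eq_single (Fin.append y x)]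
  · simp [append_comp_castAdd, append_comp_natAdd]
  · intro z _ hz
    by_cases h₁ : y = z ∘ Fin.castAdd n
    · by_cases h₂ : z ∘ Fin.natAdd m = x
      · refine absurd ?_ hz
        rw [h₁, ← h₂, append_comp_castAdd_natAdd]
      · simp [h₂]
    · simp [h₁]
  · simp
end

section
/- Pivoting on bipartite graph states via Hadamards (semantic content of Lemma 5.3): let m, n ≥ 1, let Γ be a matrix over ZMod 2 of size m×n with Γ 0 0 = 1, and define Γ' over ZMod 2 of size m×n by Γ' j k = Γ j k + (Γ j 0)·(Γ 0 k) when j ≠ 0 and k ≠ 0, and Γ' j k = Γ j k otherwise. Then for all x : Fin n → ZMod 2 and y : Fin m → ZMod 2: (1/2) · Σ_{a, b ∈ ZMod 2} χ(x 0 · a) · χ(y 0 · b) · χ(⟨Function.update y 0 b, Γ.mulVec (Function.update x 0 a)⟩) = χ(⟨Function.update y 0 (x 0), Γ'.mulVec (Function.update x 0 (y 0))⟩). (This says that applying a Hadamard to the first vertex of each part of the bipartite graph state of Γ yields the bipartite graph state of the pivoted graph Γ', with the two pivot vertices exchanged.) -/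
open Matrix

theorem sum_update_mul_mulVec_update {R : Type*} [CommSemiring R] {m n : ℕ}
    (M : Matrix (Fin (m + 1)) (Fin (n + 1)) R) (x : Fin (n + 1) → R) (y : Fin (m + 1) → R)
    (a b : R) :
    ∑ j, Function.update y 0 b j * M.mulVec (Function.update x 0 a) j =
      b * (M 0 0 * a + ∑ k : Fin n, M 0 k.succ * x k.succ) +
        ((∑ j : Fin m, y j.succ * M j.succ 0) * a +
          ∑ j : Fin m, ∑ k : Fin n, y j.succ * (M j.succ k.succ * x k.succ)) := by
  simp [Fin.sum_univ_succ, mulVec, dotProduct, mul_add, Finset.sum_add_distrib,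
    Finset.sum_mul, Finset.mul_sum, mul_assoc]
  abel

/-- The two-qubit identity behind pivoting: a double Hadamard sum of an edge phase. -/
theorem half_sum_χ_edge (s t p q r : ZMod 2) :
    (1 / 2 : ℂ) * ∑ a : ZMod 2, ∑ b : ZMod 2,
        χ (s * a) * χ (t * b) * χ (b * (a + p) + (q * a + r)) =
      χ (s * (t + p) + (q * t + (r + q * p))) := by
  have h : (1 : ZMod 2) + 1 = 0 := rfl
  have hs (f : ZMod 2 → ℂ) : ∑ a, f a = f 0 + f 1 := Fin.sum_univ_two f
  have hz (c : ZMod 2) : c = 0 ∨ c = 1 := by revert c; decide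
  simp only [hs]
  rcases hz s with rfl | rfl <;> rcases hz t with rfl | rfl <;> rcases hz p with rfl | rfl <;>
    rcases hz q with rfl | rfl <;> rcases hz r with rfl | rfl <;>
    simp only [mul_zero, mul_one, add_zero, zero_add, h] <;>
    simp only [χ, one_ne_zero, if_true, if_false] <;> norm_num

theorem pivot_via_hadamards {m n : ℕ}
    (Γ : Matrix (Fin (m + 1)) (Fin (n + 1)) (ZMod 2)) (hΓ : Γ 0 0 = 1)
    (Γ' : Matrix (Fin (m + 1)) (Fin (n + 1)) (ZMod 2))
    (hΓ' : ∀ j k, Γ' j k =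
      if j ≠ 0 ∧ k ≠ 0 then Γ j k + Γ j 0 * Γ 0 k else Γ j k)
    (x : Fin (n + 1) → ZMod 2) (y : Fin (m + 1) → ZMod 2) :
    (1 / 2 : ℂ) * ∑ a : ZMod 2, ∑ b : ZMod 2,
        χ (x 0 * a) * χ (y 0 * b) *
          χ (∑ j, Function.update y 0 b j * Γ.mulVec (Function.update x 0 a) j) =
      χ (∑ j, Function.update y 0 (x 0) j *
          Γ'.mulVec (Function.update x 0 (y 0)) j) := by
  have hcorner : ∑ j : Fin m, ∑ k : Fin n, y j.succ * (Γ' j.succ k.succ * x k.succ) =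
      ∑ j : Fin m, ∑ k : Fin n, y j.succ * (Γ j.succ k.succ * x k.succ) +
        (∑ j : Fin m, y j.succ * Γ j.succ 0) * ∑ k : Fin n, Γ 0 k.succ * x k.succ := by
    simp only [Finset.sum_mul_sum, ← Finset.sum_add_distrib]
    refine Finset.sum_congr rfl fun j _ => Finset.sum_congr rfl fun k _ => ?_
    rw [hΓ', if_pos ⟨Fin.succ_ne_zero j, Fin.succ_ne_zero k⟩]
    ring
  have hrow (k) : Γ' 0 k = Γ 0 k := by simp [hΓ']
  have hcol (j) : Γ' j 0 = Γ j 0 := by simp [hΓ']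
  simp only [sum_update_mul_mulVec_update, hcorner, hrow, hcol, hΓ, one_mul]
  exact half_sum_χ_edge _ _ _ _ _
end

section
/- Inductive construction of graph states (semantic content of Definition 5.4 and Lemma 5.5): let G be a simple graph on Fin (n+1), let u = 0 be its first vertex, and let G' be the induced subgraph of G on the remaining n vertices (so G'.Adj i j ↔ G.Adj i.succ j.succ for i, j : Fin n). Then for every a ∈ ZMod 2 and every x : Fin n → ZMod 2, |G⟩(Fin.cons a x) = 2^{-1/2} · χ(a · Σ_{i : Fin n, i.succ ∈ N_G(0)} x i) · |G'⟩(x), where the sum is over ZMod 2. (This says |G⟩ is obtained from |G'⟩ by adjoining a qubit in the |+⟩ state and applying controlled-Z between it and the neighbours of u.) -/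
open Matrix Finset

/-- The sign contributed by an edge `{u, v}`: `-1` if `x u = 1` and `x v = 1`,
and `1` otherwise (i.e. `(-1)^{x_u · x_v}`). -/
noncomputable def edgeSign {n : ℕ} (x : Fin n → ZMod 2) (e : Sym2 (Fin n)) : ℂ :=
  χ (Sym2.lift ⟨fun u v => x u * x v, fun _ _ => mul_comm _ _⟩ e)

/-- The graph state of a simple graph `G` on `Fin n`:
`|G⟩(x) = 2^{-n/2} · ∏_{e ∈ E(G)} s_e(x)`. -/
noncomputable def graphState {n : ℕ} (G : SimpleGraph (Fin n)) [DecidableRel G.Adj]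
    (x : Fin n → ZMod 2) : ℂ :=
  (Real.sqrt 2 : ℂ)⁻¹ ^ n * ∏ e ∈ G.edgeFinset, edgeSign x e

theorem χ_add (c d : ZMod 2) : χ (c + d) = χ c * χ d := by
  have eq_zero_or_one : ∀ z : ZMod 2, z = 0 ∨ z = 1 := by decide
  rcases eq_zero_or_one c with rfl | rfl <;> rcases eq_zero_or_one d with rfl | rfl <;>
    simp [χ, CharTwo.add_self_eq_zero]

theorem χ_sum {ι : Type*} (s : Finset ι) (f : ι → ZMod 2) :
    χ (∑ i ∈ s, f i) = ∏ i ∈ s, χ (f i) := by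
  classical
  induction s using Finset.induction_on with
  | empty => simp [χ]
  | insert i s hi ih => rw [Finset.sum_insert hi, Finset.prod_insert hi, χ_add, ih]

theorem edgeSign_mk {n : ℕ} (x : Fin n → ZMod 2) (i j : Fin n) :
    edgeSign x s(i, j) = χ (x i * x j) := rfl

theorem edgeSign_cons_map_succ {n : ℕ} (a : ZMod 2) (x : Fin n → ZMod 2) (e : Sym2 (Fin n)) :
    edgeSign (Fin.cons a x : Fin (n + 1) → ZMod 2) (e.map Fin.succ) = edgeSign x e := by
  induction e with
  | _ i j => simp [edgeSign_mk]

/-- The edges of a graph on `Fin (n + 1)` are those at the vertex `0` and those of the graph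
induced on the successors. -/
theorem edgeFinset_eq_union_succ {n : ℕ} (G : SimpleGraph (Fin (n + 1)))
    [DecidableRel G.Adj] (G' : SimpleGraph (Fin n)) [DecidableRel G'.Adj]
    (hG' : ∀ i j : Fin n, G'.Adj i j ↔ G.Adj i.succ j.succ) :
    G.edgeFinset =
      (Finset.univ.filter fun i : Fin n => G.Adj 0 i.succ).image
          (fun i => s((0 : Fin (n + 1)), i.succ)) ∪
        G'.edgeFinset.image (Sym2.map Fin.succ) := by
  ext e
  simp only [Finset.mem_union, Finset.mem_image, Finset.mem_filter, Finset.mem_univ, true_and,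
    SimpleGraph.mem_edgeFinset]
  constructor
  · induction e with
    | _ u v =>
      intro h
      rw [SimpleGraph.mem_edgeSet] at h
      cases u using Fin.cases with
      | zero =>
        cases v using Fin.cases with
        | zero => exact (G.loopless.irrefl _ h).elim
        | succ j => exact Or.inl ⟨j, h, rfl⟩
      | succ i =>
        cases v using Fin.cases with
        | zero => exact Or.inl ⟨i, h.symm, Sym2.eq_swap⟩
        | succ j => exact Or.inr ⟨s(i, j), (hG' i j).2 h, rfl⟩
  · rintro (⟨i, h, rfl⟩ | ⟨e, h, rfl⟩)
    · exact h
    · induction e with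
      | _ i j => exact (hG' i j).1 h

theorem disjoint_image_zero_image_map_succ {n : ℕ} (s : Finset (Fin n))
    (t : Finset (Sym2 (Fin n))) :
    Disjoint (s.image fun i => s((0 : Fin (n + 1)), i.succ)) (t.image (Sym2.map Fin.succ)) := by
  rw [Finset.disjoint_left]
  simp only [Finset.mem_image, not_exists, not_and]
  rintro _ ⟨i, -, rfl⟩ e - he
  have h : (0 : Fin (n + 1)) ∈ e.map Fin.succ := he ▸ Sym2.mem_mk_left _ _
  obtain ⟨j, -, hj⟩ := Sym2.mem_map.1 h
  exact Fin.succ_ne_zero j hj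

theorem graphState_inductive {n : ℕ} (G : SimpleGraph (Fin (n + 1)))
    [DecidableRel G.Adj] (G' : SimpleGraph (Fin n)) [DecidableRel G'.Adj]
    (hG' : ∀ i j : Fin n, G'.Adj i j ↔ G.Adj i.succ j.succ)
    (a : ZMod 2) (x : Fin n → ZMod 2) :
    graphState G (Fin.cons a x) =
      (Real.sqrt 2 : ℂ)⁻¹ *
        χ (a * ∑ i ∈ Finset.univ.filter (fun i : Fin n => G.Adj 0 i.succ), x i) *
        graphState G' x := by
  have hstar : Function.Injective fun i : Fin n => s((0 : Fin (n + 1)), i.succ) :=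
    fun i j h => Fin.succ_injective n (Sym2.congr_right.1 h)
  have hmap := Sym2.map.injective (Fin.succ_injective n)
  unfold graphState
  rw [edgeFinset_eq_union_succ G G' hG',
    Finset.prod_union (disjoint_image_zero_image_map_succ _ _),
    Finset.prod_image hstar.injOn, Finset.prod_image hmap.injOn, Finset.mul_sum, χ_sum]
  simp only [edgeSign_cons_map_succ, edgeSign_mk, Fin.cons_zero, Fin.cons_succ]
  ring
end
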